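/- Every quantum channel that maps the set of states surjectively onto itself is unitary: let Φ(X) = ∑_k A_k X A_kᴴ with ∑_k A_kᴴ A_k = 1 be a quantum channel on d×d complex matrices, and suppose the image under Φ of the set of density matrices equals the set of density matrices, i.e. { Φ(ρ) : ρ positive semidefinite with trace 1 } = { σ : σ positive semidefinite with trace 1 }. Then there exists a unitary d×d matrix U with Φ(X) = U X Uᴴ for every d×d matrix X. -/

import Mathlib

open Matrix BigOperators
open scoped ComplexOrder

lemma eq_zero_of_sum_mul_conjTranspose_eq_zero {K m n : Type*} [Fintype K] [Fintype m]
    [Fintype n] (M : K → Matrix m n ℂ) (h : ∑ k, M k * (M k)ᴴ = 0) (k : K) : M k = 0 := by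
  have htr : ∑ k, (M k * (M k)ᴴ).trace = 0 := by rw [← trace_sum, h, trace_zero]
  rw [Finset.sum_eq_zero_iff_of_nonneg
    fun k _ => (posSemidef_self_mul_conjTranspose (M k)).trace_nonneg] at htr
  exact trace_mul_conjTranspose_self_eq_zero_iff.mp (htr k (Finset.mem_univ k))

open scoped MatrixOrder Matrix.Norms.L2Operator in
/-- If the completely positive map with Kraus operators `A k` maps some state to the pure state
along `v`, then some nonzero vector is mapped into the line of `v` by every `A k`. -/
lemma exists_mulVec_eq_smul_of_pure_state {K n : Type*} [Fintype K] [Fintype n] [DecidableEq n]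
    (A : K → Matrix n n ℂ) (v : n → ℂ) (hv : v ≠ 0) (ρ : Matrix n n ℂ) (hρ : ρ.PosSemidef)
    (htr : ρ.trace = 1)
    (h : ∑ k, A k * ρ * (A k)ᴴ = (star v ⬝ᵥ v)⁻¹ • vecMulVec v (star v)) :
    ∃ w : n → ℂ, w ≠ 0 ∧ ∃ c : K → ℂ, ∀ k, A k *ᵥ w = c k • v := by
  have hN : star v ⬝ᵥ v ≠ 0 := dotProduct_star_self_eq_zero.not.mpr hv
  obtain ⟨B, rfl⟩ : ∃ B : Matrix n n ℂ, ρ = Bᴴ * B :=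
    CStarAlgebra.nonneg_iff_eq_star_mul_self.mp hρ.nonneg
  set P : Matrix n n ℂ := 1 - (star v ⬝ᵥ v)⁻¹ • vecMulVec v (star v) with hP
  have hPv : P *ᵥ v = 0 := by
    rw [hP, sub_mulVec, one_mulVec, smul_mulVec, vecMulVec_mulVec]
    ext i
    simp [field]
  have hzero (k : K) : P * A k * Bᴴ = 0 := by
    refine eq_zero_of_sum_mul_conjTranspose_eq_zero (fun k => P * A k * Bᴴ) ?_ k
    calc ∑ k, P * A k * Bᴴ * (P * A k * Bᴴ)ᴴ
        = P * (∑ k, A k * (Bᴴ * B) * (A k)ᴴ) * Pᴴ := by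
          simp only [Finset.mul_sum, Finset.sum_mul, conjTranspose_mul,
            conjTranspose_conjTranspose, Matrix.mul_assoc]
      _ = 0 := by simp [h, mul_vecMulVec, hPv]
  obtain ⟨j, hj⟩ : ∃ j, Bᴴ.col j ≠ 0 := by
    by_contra! hcol
    have hB : Bᴴ = 0 := by
      ext i j
      exact congrFun (hcol j) i
    simp [hB] at htr
  refine ⟨Bᴴ.col j, hj, fun k => (star v ⬝ᵥ v)⁻¹ * (star v ⬝ᵥ A k *ᵥ Bᴴ.col j), fun k => ?_⟩
  have hk : P *ᵥ (A k *ᵥ Bᴴ.col j) = 0 := by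
    rw [mulVec_mulVec]
    ext i
    exact congrFun (congrFun (hzero k) i) j
  rw [hP, sub_mulVec, one_mulVec, smul_mulVec, vecMulVec_mulVec, sub_eq_zero] at hk
  rw [hk]
  ext i
  simp
  ring

/-- Matrices without a common kernel whose preimages of every line share a nonzero vector
are all proportional to a single matrix. -/
lemma exists_eq_smul_of_exists_mulVec_eq_smul {K n : Type*} [Fintype n] [DecidableEq n]
    [Nonempty n] (A : K → Matrix n n ℂ)
    (hker : ∀ w : n → ℂ, (∀ k, A k *ᵥ w = 0) → w = 0)
    (hline : ∀ v : n → ℂ, v ≠ 0 →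
      ∃ w : n → ℂ, w ≠ 0 ∧ ∃ c : K → ℂ, ∀ k, A k *ᵥ w = c k • v) :
    ∃ (B : Matrix n n ℂ) (c : K → ℂ), ∀ k, A k = c k • B := by
  obtain ⟨o⟩ := ‹Nonempty n›
  choose w hw c hc using fun i : n => hline (Pi.single i 1) (by simp)
  have hcne (i : n) : c i ≠ 0 := fun h0 => hw i (hker _ fun k => by simp [hc, h0])
  set W : Matrix n n ℂ := (of w)ᵀ with hW
  have hAW (k : K) : A k * W = diagonal fun i => c i k := by
    ext i j
    have := congrFun (hc j k) i
    rw [← diagonal_transpose, transpose_apply]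
    simpa [diagonal_apply, eq_comm, Pi.single_apply, hW, mul_apply, mulVec, dotProduct] using this
  have hWunit : IsUnit W := by
    rw [← mulVec_injective_iff_isUnit]
    refine (injective_iff_map_eq_zero W.mulVecLin).mpr fun x hx => ?_
    ext i
    obtain ⟨k, hk⟩ := Function.ne_iff.mp (hcne i)
    have : (A k * W) *ᵥ x = 0 := by
      rw [← mulVec_mulVec, show W *ᵥ x = 0 from hx, mulVec_zero]
    rw [hAW] at this
    have := congrFun this i
    rw [mulVec_diagonal] at this
    exact (mul_eq_zero.mp this).resolve_left hk
  have hWdet := (isUnit_iff_isUnit_det W).mp hWunit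
  have hprop (i : n) : ∃ t : ℂ, ∀ k, c i k = t * c o k := by
    by_cases hi : i = o
    · exact ⟨1, fun k => by simp [hi]⟩
    obtain ⟨x, hx, b, hb⟩ := hline (Pi.single i 1 + Pi.single o 1) fun h => by
      simpa [hi] using congrFun h i
    obtain ⟨y, rfl⟩ : ∃ y, W *ᵥ y = x := ⟨W⁻¹ *ᵥ x, by
      rw [mulVec_mulVec, mul_nonsing_inv _ hWdet, one_mulVec]⟩
    simp only [mulVec_mulVec, hAW] at hb
    have hbi (k : K) : c i k * y i = b k := by
      simpa [mulVec_diagonal, hi] using congrFun (hb k) i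
    have hbo (k : K) : c o k * y o = b k := by
      simpa [mulVec_diagonal, Ne.symm hi] using congrFun (hb k) o
    have hyi : y i ≠ 0 := fun h0 => hx (hker _ fun k => by
      simp [hb, hAW, ← hbi, h0])
    refine ⟨y o / y i, fun k => ?_⟩
    have := (hbi k).trans (hbo k).symm
    field_simp
    linear_combination this
  choose t ht using hprop
  refine ⟨diagonal t * W⁻¹, c o, fun k => ?_⟩
  have hdiag : A k * W = c o k • diagonal t := by
    rw [hAW, ← diagonal_smul]
    congr 1
    ext i
    simp [ht i k, mul_comm]
  rw [← Matrix.smul_mul, ← hdiag, mul_nonsing_inv_cancel_right _ _ hWdet]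

/-- every quantum channel mapping the set of density matrices
surjectively onto itself is unitary. -/
theorem clean_povm_stmt17 (d : ℕ) (hd : 1 ≤ d) (K : Type) [Fintype K]
    (A : K → Matrix (Fin d) (Fin d) ℂ)
    (hA : ∑ k, (A k)ᴴ * A k = 1)
    (hsurj : {σ : Matrix (Fin d) (Fin d) ℂ |
        ∃ ρ : Matrix (Fin d) (Fin d) ℂ, ρ.PosSemidef ∧ ρ.trace = 1 ∧
          ∑ k, A k * ρ * (A k)ᴴ = σ} =
      {σ : Matrix (Fin d) (Fin d) ℂ | σ.PosSemidef ∧ σ.trace = 1}) :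
    ∃ U : Matrix (Fin d) (Fin d) ℂ, Uᴴ * U = 1 ∧
      ∀ X : Matrix (Fin d) (Fin d) ℂ, ∑ k, A k * X * (A k)ᴴ = U * X * Uᴴ := by
  have : Nonempty (Fin d) := ⟨⟨0, hd⟩⟩
  have hker (w : Fin d → ℂ) (hw : ∀ k, A k *ᵥ w = 0) : w = 0 := by
    rw [← one_mulVec w, ← hA, sum_mulVec]
    exact Finset.sum_eq_zero fun k _ => by rw [← mulVec_mulVec, hw, mulVec_zero]
  have hline (v : Fin d → ℂ) (hv : v ≠ 0) :
      ∃ w : Fin d → ℂ, w ≠ 0 ∧ ∃ c : K → ℂ, ∀ k, A k *ᵥ w = c k • v := by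
    have hN : star v ⬝ᵥ v ≠ 0 := dotProduct_star_self_eq_zero.not.mpr hv
    have hmem : (star v ⬝ᵥ v)⁻¹ • vecMulVec v (star v) ∈
        {σ : Matrix (Fin d) (Fin d) ℂ | σ.PosSemidef ∧ σ.trace = 1} := by
      refine ⟨(posSemidef_vecMulVec_self_star v).smul
        (inv_nonneg.mpr (dotProduct_star_self_nonneg v)), ?_⟩
      rw [trace_smul, trace_vecMulVec, dotProduct_comm v, smul_eq_mul, inv_mul_cancel₀ hN]
    rw [← hsurj] at hmem
    obtain ⟨ρ, hρ, htr, h⟩ := hmem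
    exact exists_mulVec_eq_smul_of_pure_state A v hv ρ hρ htr h
  obtain ⟨B, c, hB⟩ := exists_eq_smul_of_exists_mulVec_eq_smul A hker hline
  set s : ℝ := √(∑ k, ‖c k‖ ^ 2) with hs
  have hss : (s : ℂ) * s = ∑ k, c k * star (c k) := by
    rw [← Complex.ofReal_mul, hs, Real.mul_self_sqrt (by positivity)]
    simp [Complex.mul_conj']
  refine ⟨(s : ℂ) • B, ?_, fun X => ?_⟩
  · rw [← hA]
    simp only [hB, conjTranspose_smul, Matrix.smul_mul, Matrix.mul_smul, smul_smul,
      ← Finset.sum_smul]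
    simp [hss]
  · simp only [hB, conjTranspose_smul, Matrix.smul_mul, Matrix.mul_smul, smul_smul,
      ← Finset.sum_smul]
    simp [hss, mul_comm]
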